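/- arXiv:1603.08623 — 4 statements merged into one kernel-verified Lean document; each statement's English description precedes it below -/
import Mathlib

section
/- Let f(X) ∈ ℤ[X] be a polynomial of degree n with content 1 and nonzero discriminant, let p be a prime, and let k be a positive integer. Let s be the number of roots α of f in an algebraic closure of ℚ_p that are integral over ℤ_p (equivalently, with |α|_p ≤ 1). Then there exist an integer t with 0 ≤ t ≤ s, non-negative integers c₁, …, c_t, and integers u₁, …, u_t with 0 ≤ uᵢ ≤ k, such that: (1) the set of integers X with f(X) ≡ 0 (mod p^k) is exactly the union over i = 1, …, t of the congruence classes {X ∈ ℤ : X ≡ cᵢ (mod p^{k−uᵢ})}; and (2) for each i, p^k divides every coefficient of the polynomial f(p^{k−uᵢ}X + cᵢ). -/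
open Finset

/-- Evaluation of the binary form of degree `n` with coefficient vector `c` at `(x, y)`:
`c 0 * x^n + c 1 * x^(n-1) * y + ⋯ + c n * y^n`. -/
def binEval {n : ℕ} {R : Type*} [CommRing R] (c : Fin (n + 1) → R) (x y : R) : R :=
  ∑ i : Fin (n + 1), c i * x ^ (n - (i : ℕ)) * y ^ (i : ℕ)

/-- The binary form with coefficient vector `c` as an element of `MvPolynomial (Fin 2) R`. -/
noncomputable def formPolyR {n : ℕ} {R : Type*} [CommRing R] (c : Fin (n + 1) → R) :
    MvPolynomial (Fin 2) R :=
  ∑ i : Fin (n + 1), MvPolynomial.C (c i) * MvPolynomial.X 0 ^ (n - (i : ℕ)) *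
    MvPolynomial.X 1 ^ (i : ℕ)

/-- The binary form with integer coefficient vector `c`, base-changed to `R`. -/
noncomputable def formPoly {n : ℕ} (R : Type*) [CommRing R] (c : Fin (n + 1) → ℤ) :
    MvPolynomial (Fin 2) R :=
  formPolyR (fun i => ((c i : R)))

/-- `F(X, 1)` over `R`, for the binary form with integer coefficient vector `c`. -/
noncomputable def formPolyX {n : ℕ} (R : Type*) [CommRing R] (c : Fin (n + 1) → ℤ) :
    Polynomial R :=
  ∑ i : Fin (n + 1), Polynomial.C ((c i : R)) * Polynomial.X ^ (n - (i : ℕ))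

/-- `IsDisc c D`: the binary form with coefficient vector `c` factors over `ℂ` as
`∏ (αᵢ x - βᵢ y)` and `D = ∏_{i<j} (αᵢ βⱼ - αⱼ βᵢ)²` is its discriminant. -/
def IsDisc {n : ℕ} (c : Fin (n + 1) → ℤ) (D : ℤ) : Prop :=
  ∃ α β : Fin n → ℂ,
    (∀ x y : ℂ, binEval (fun i => ((c i : ℂ))) x y = ∏ i : Fin n, (α i * x - β i * y)) ∧
    (D : ℂ) = ∏ i : Fin n, ∏ j ∈ Finset.univ.filter (fun j => i < j),
      (α i * β j - α j * β i) ^ 2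

/-- `G` is a maximal form: it is not a proper subform of any integral binary form. -/
def IsMaximalForm {n : ℕ} (G : Fin (n + 1) → ℤ) : Prop :=
  ¬ ∃ (F : Fin (n + 1) → ℤ) (a b c d : ℤ), 1 < |a * d - b * c| ∧
      ∀ x y : ℤ, binEval G x y = binEval F (a * x + b * y) (c * x + d * y)

/-- `GL₂(ℤ)`-equivalence of integral binary forms. -/
def FormEquiv {n : ℕ} (F G : Fin (n + 1) → ℤ) : Prop :=
  ∃ a b c d : ℤ, |a * d - b * c| = 1 ∧
    ∀ x y : ℤ, binEval G x y = binEval F (a * x + b * y) (c * x + d * y)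

/-- The form locally represents `h` everywhere: over `ℝ` and over `ℤ_p` for all primes `p`. -/
def LocallyRep {n : ℕ} (c : Fin (n + 1) → ℤ) (h : ℤ) : Prop :=
  (∃ x y : ℝ, binEval (fun i => ((c i : ℝ))) x y = (h : ℝ)) ∧
  ∀ (p : ℕ) (hp : p.Prime),
    haveI : Fact p.Prime := ⟨hp⟩
    ∃ x y : ℤ_[p], binEval (fun i => ((c i : ℤ_[p]))) x y = (h : ℤ_[p])

/-- The integral binary form is primitive: the gcd of its coefficients is 1. -/
def IsPrimitiveForm {n : ℕ} (c : Fin (n + 1) → ℤ) : Prop :=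
  ∀ d : ℤ, (∀ i, d ∣ c i) → IsUnit d

/-- The form splits completely modulo `p`: modulo `p` it is a product of pairwise
non-proportional linear forms over `ℤ/pℤ`. -/
def SplitsCompletelyMod (p : ℕ) {n : ℕ} (c : Fin (n + 1) → ℤ) : Prop :=
  ∃ L : Fin n → ZMod p × ZMod p,
    (∀ i j, i ≠ j → (L i).1 * (L j).2 ≠ (L j).1 * (L i).2) ∧
    formPoly (ZMod p) c =
      ∏ i : Fin n, (MvPolynomial.C (L i).1 * MvPolynomial.X 0 +
        MvPolynomial.C (L i).2 * MvPolynomial.X 1)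

open Polynomial in
theorem Polynomial.comp_C_mul_X_add_C_coeff {R : Type*} [CommRing R] (f : R[X]) (d x : R) (j : ℕ) :
    (f.comp (C d * X + C x)).coeff j = (taylor x f).coeff j * d ^ j := by
  have h : f.comp (C d * X + C x) = (taylor x f).comp (C d * X) := by
    simp [taylor_apply, comp_assoc]
  rw [h, comp_C_mul_X_coeff]

open Polynomial in
theorem Polynomial.C_dvd_comp_of_dvd_sub {R : Type*} [CommRing R] {f : R[X]} {N d x y : R}
    (h : C N ∣ f.comp (C d * X + C x)) (hxy : d ∣ y - x) :
    C N ∣ f.comp (C d * X + C y) := by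
  obtain ⟨z, hz⟩ := hxy
  obtain ⟨g, hg⟩ := h
  have h1 : f.comp (C d * X + C y) = (f.comp (C d * X + C x)).comp (X + C z) := by
    rw [comp_assoc]
    congr 1
    rw [show y = x + d * z by rw [← hz]; ring]
    simp
    ring
  exact ⟨g.comp (X + C z), by rw [h1, hg]; simp⟩

open Polynomial in
theorem Polynomial.dvd_eval_of_C_dvd_comp {R : Type*} [CommRing R] {f : R[X]} {N d x : R}
    (h : C N ∣ f.comp (C d * X + C x)) : N ∣ f.eval x := by
  obtain ⟨g, hg⟩ := h
  exact ⟨g.eval 0, by simpa using congrArg (Polynomial.eval 0) hg⟩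

open Polynomial in
theorem Polynomial.C_dvd_comp_of_dvd_eval {R : Type*} [CommRing R] {f : R[X]} {N x : R}
    (h : N ∣ f.eval x) : C N ∣ f.comp (C N * X + C x) := by
  rw [C_dvd_iff_dvd_coeff]
  intro j
  rw [comp_C_mul_X_add_C_coeff]
  rcases j with _ | j
  · simpa using h
  · exact Dvd.dvd.mul_left (dvd_pow_self N (by simp)) _

open Polynomial in
theorem Polynomial.C_dvd_of_C_dvd_comp_X_add_C {R : Type*} [CommRing R] {f : R[X]} {N x : R}
    (h : C N ∣ f.comp (X + C x)) : C N ∣ f := by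
  obtain ⟨g, hg⟩ := h
  have h1 : f = (f.comp (X + C x)).comp (X - C x) := by simp [comp_assoc]
  exact ⟨g.comp (X - C x), by rw [h1, hg]; simp⟩

/-- If all roots of a split polynomial have norm at least `r`, then its constant term dominates
on the disc of radius `r`. -/
theorem Polynomial.Splits.norm_coeff_mul_pow_le {L : Type*} [NormedField L] [IsUltrametricDist L]
    {g : Polynomial L} (hg : g.Splits) {r : ℝ} (hr : 0 ≤ r)
    (hroots : ∀ β ∈ g.roots, r ≤ ‖β‖) (j : ℕ) :
    ‖g.coeff j‖ * r ^ j ≤ ‖g.coeff 0‖ := by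
  have mul : ∀ a b : Polynomial L, (∀ j, ‖a.coeff j‖ * r ^ j ≤ ‖a.coeff 0‖) →
      (∀ j, ‖b.coeff j‖ * r ^ j ≤ ‖b.coeff 0‖) →
      ∀ j, ‖(a * b).coeff j‖ * r ^ j ≤ ‖(a * b).coeff 0‖ := by
    intro a b ha hb j
    rw [Polynomial.coeff_mul, Polynomial.mul_coeff_zero, norm_mul]
    obtain ⟨i, hi, hle⟩ := IsUltrametricDist.exists_norm_finsetSum_le_of_nonempty
      (t := Finset.HasAntidiagonal.antidiagonal j) ⟨(0, j), by simp⟩ (fun i => a.coeff i.1 * b.coeff i.2)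
    rw [Finset.HasAntidiagonal.mem_antidiagonal] at hi
    calc _ ≤ ‖a.coeff i.1 * b.coeff i.2‖ * r ^ j := by gcongr
      _ = (‖a.coeff i.1‖ * r ^ i.1) * (‖b.coeff i.2‖ * r ^ i.2) := by
        rw [norm_mul, ← hi, pow_add]; ring
      _ ≤ _ := mul_le_mul (ha _) (hb _) (by positivity) (norm_nonneg _)
  have const : ∀ a : L, ∀ j, ‖(Polynomial.C a).coeff j‖ * r ^ j ≤ ‖(Polynomial.C a).coeff 0‖ := by
    intro a j
    rcases j with _ | j <;> simp [Polynomial.coeff_C]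
  have prod : ∀ s : Multiset L, (∀ β ∈ s, r ≤ ‖β‖) →
      ∀ j, ‖(s.map fun β => Polynomial.X - Polynomial.C β).prod.coeff j‖ * r ^ j ≤
        ‖(s.map fun β => Polynomial.X - Polynomial.C β).prod.coeff 0‖ := by
    intro s
    induction s using Multiset.induction_on with
    | empty => intro _ ; simpa using const 1
    | cons β s ih =>
      intro hs
      rw [Multiset.map_cons, Multiset.prod_cons]
      refine mul _ _ ?_ (ih fun γ hγ => hs γ (Multiset.mem_cons_of_mem hγ))
      intro j
      rcases j with _ | _ | j
      · simp
      · simpa using hs β (Multiset.mem_cons_self _ _)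
      · simp [Polynomial.coeff_X, Polynomial.coeff_C]
  rw [hg.eq_prod_roots]
  exact mul _ _ (const _) (prod _ hroots) j

theorem PadicAlgCl.norm_intCast_le_iff {p : ℕ} [Fact p.Prime] (a : ℤ) (k : ℕ) :
    ‖(a : PadicAlgCl p)‖ ≤ ((p : ℝ)⁻¹) ^ k ↔ (p : ℤ) ^ k ∣ a := by
  rw [← map_intCast (algebraMap ℚ_[p] (PadicAlgCl p)), PadicAlgCl.norm_extends,
    ← Padic.norm_int_le_pow_iff_dvd]
  simp

theorem PadicAlgCl.norm_intCast_lt_iff {p : ℕ} [Fact p.Prime] (a : ℤ) (k : ℕ) :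
    ‖(a : PadicAlgCl p)‖ < ((p : ℝ)⁻¹) ^ k ↔ (p : ℤ) ^ (k + 1) ∣ a := by
  rw [← PadicAlgCl.norm_intCast_le_iff (p := p), ← map_intCast (algebraMap ℚ_[p] (PadicAlgCl p)),
    PadicAlgCl.norm_extends]
  have h := Padic.norm_le_pow_iff_norm_lt_pow_add_one (a : ℚ_[p]) (-((k + 1 : ℕ) : ℤ))
  rw [show -((k + 1 : ℕ) : ℤ) + 1 = -(k : ℤ) by push_cast; ring] at h
  simp only [zpow_neg, zpow_natCast] at h
  rw [inv_pow, inv_pow, h]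

theorem PadicAlgCl.norm_intCast_le_one {p : ℕ} [Fact p.Prime] (a : ℤ) :
    ‖(a : PadicAlgCl p)‖ ≤ 1 := by
  simpa using (PadicAlgCl.norm_intCast_le_iff (p := p) a 0).2 (by simp)

theorem PadicAlgCl.isIntegralElem_of_norm_le_one {p : ℕ} [Fact p.Prime] {α : PadicAlgCl p}
    (hα : ‖α‖ ≤ 1) :
    ((algebraMap ℚ_[p] (AlgebraicClosure ℚ_[p])).comp
      (PadicInt.Coe.ringHom)).IsIntegralElem α := by
  have hint : IsIntegral ℚ_[p] α := Algebra.IsIntegral.isIntegral α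
  have hm := minpoly.monic hint
  have hc : ∀ n, ‖(minpoly ℚ_[p] α).coeff n‖ ≤ 1 := (spectralValue_le_one_iff hm).1 hα
  have hl : minpoly ℚ_[p] α ∈ Polynomial.lifts (PadicInt.Coe.ringHom (p := p)) := by
    rw [Polynomial.lifts_iff_coeff_lifts]
    exact fun n => ⟨⟨_, hc n⟩, rfl⟩
  obtain ⟨q, hq, -, hqm⟩ := Polynomial.lifts_and_natDegree_eq_and_monic hl hm
  refine ⟨q, hqm, ?_⟩
  rw [← Polynomial.eval₂_map, hq]
  exact minpoly.aeval ℚ_[p] α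

/-- If no root of `f` is closer to `x` than `p ^ (-e)`, then divisibility of `f(x)` by `p ^ k`
propagates to the whole disc of radius `p ^ (-e)` about `x`. -/
theorem PadicAlgCl.C_dvd_comp_of_forall_root_le_norm_sub {p : ℕ} [Fact p.Prime] {f : Polynomial ℤ}
    {k e : ℕ} {x : ℤ} (hx : (p : ℤ) ^ k ∣ f.eval x)
    (hroots : ∀ α : PadicAlgCl p, Polynomial.aeval α f = 0 →
      ((p : ℝ)⁻¹) ^ e ≤ ‖α - (x : PadicAlgCl p)‖) :
    Polynomial.C ((p : ℤ) ^ k) ∣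
      f.comp (Polynomial.C ((p : ℤ) ^ e) * Polynomial.X + Polynomial.C x) := by
  rw [Polynomial.C_dvd_iff_dvd_coeff]
  intro j
  rw [Polynomial.comp_C_mul_X_add_C_coeff, ← PadicAlgCl.norm_intCast_le_iff (p := p)]
  set g : Polynomial (PadicAlgCl p) := (Polynomial.taylor x f).map (Int.castRingHom _) with hg
  have hroots' : ∀ β ∈ g.roots, ((p : ℝ)⁻¹) ^ e ≤ ‖β‖ := by
    intro β hβ
    have hβ0 := (Polynomial.mem_roots'.1 hβ).2
    have := hroots (β + x) (by
      rw [Polynomial.IsRoot.def, hg, Polynomial.taylor_apply, Polynomial.map_comp] at hβ0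
      rw [Polynomial.aeval_def, RingHom.ext_int (algebraMap ℤ (PadicAlgCl p)) (Int.castRingHom _)]
      simpa [Polynomial.eval_map] using hβ0)
    simpa using this
  have key := (IsAlgClosed.splits g).norm_coeff_mul_pow_le (by positivity) hroots' j
  have hp : ‖((p : ℤ) : PadicAlgCl p)‖ ≤ (p : ℝ)⁻¹ := by
    simpa using (PadicAlgCl.norm_intCast_le_iff (p := p) p 1).2 (by simp)
  have h0 : ‖g.coeff 0‖ ≤ ((p : ℝ)⁻¹) ^ k := by
    rw [hg, Polynomial.coeff_map, Polynomial.taylor_coeff_zero]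
    exact (PadicAlgCl.norm_intCast_le_iff _ _).2 hx
  refine le_trans ?_ (key.trans h0)
  rw [Int.cast_mul, norm_mul, Int.cast_pow, Int.cast_pow, norm_pow, norm_pow, hg,
    Polynomial.coeff_map]
  simp only [eq_intCast]
  gcongr

open Polynomial in
/-- If `f` vanishes modulo `p ^ k` at `x` but not identically on the disc of radius `p ^ (-e)` about
`x`, then some root of `f` lies at distance less than `p ^ (-e)` from `x`. -/
theorem PadicAlgCl.exists_root_norm_sub_lt {p : ℕ} [Fact p.Prime] {f : ℤ[X]}
    {k e : ℕ} {x : ℤ} (hx : (p : ℤ) ^ k ∣ f.eval x)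
    (he : ¬ C ((p : ℤ) ^ k) ∣ f.comp (C ((p : ℤ) ^ e) * X + C x)) :
    ∃ α : PadicAlgCl p, aeval α f = 0 ∧ ‖α - (x : PadicAlgCl p)‖ < ((p : ℝ)⁻¹) ^ e := by
  by_contra! h
  exact he (C_dvd_comp_of_forall_root_le_norm_sub hx h)

/-- Stewart's lemma on the solutions of `f(X) ≡ 0 (mod p^k)` for a squarefree
integer polynomial of content 1: the solution set is a union of at most `s` congruence
classes `X ≡ cᵢ (mod p^(k - uᵢ))`, where `s` is the number of roots of `f` integral over
`ℤ_p` in an algebraic closure of `ℚ_p`, and moreover `p^k` divides every coefficient of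
`f(p^(k-uᵢ) X + cᵢ)`. -/
theorem stewart_polynomial_congruences
    (p : ℕ) [hp : Fact p.Prime]
    (f : Polynomial ℤ) (n : ℕ) (hdeg : f.natDegree = n)
    (hcont : f.content = 1)
    (hdisc : Squarefree (f.map (Int.castRingHom ℚ))) -- nonzero discriminant
    (k : ℕ) (hk : 0 < k) :
    ∃ (t : ℕ) (c : Fin t → ℕ) (u : Fin t → ℕ),
      t ≤ Nat.card {α : AlgebraicClosure ℚ_[p] //
          Polynomial.aeval α f = 0 ∧
          ((algebraMap ℚ_[p] (AlgebraicClosure ℚ_[p])).comp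
            (PadicInt.Coe.ringHom)).IsIntegralElem α} ∧
      (∀ i, u i ≤ k) ∧
      (∀ X : ℤ, (p : ℤ) ^ k ∣ f.eval X ↔
        ∃ i : Fin t, ((p : ℤ) ^ (k - u i)) ∣ (X - (c i : ℤ))) ∧
      (∀ i : Fin t, ∀ j : ℕ, (p : ℤ) ^ k ∣
        (f.comp (Polynomial.C ((p : ℤ) ^ (k - u i)) * Polynomial.X +
          Polynomial.C ((c i : ℤ)))).coeff j) := by
  have hp1 : (1 : ℝ) < p := by exact_mod_cast hp.out.one_lt
  have hpi0 : 0 < (p : ℝ)⁻¹ := by positivity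
  have hpi1 : (p : ℝ)⁻¹ < 1 := inv_lt_one_of_one_lt₀ hp1
  have hf0 : f ≠ 0 := by rintro rfl; simp at hcont
  let P : ℤ → ℕ → Prop := fun x e => Polynomial.C ((p : ℤ) ^ k) ∣
    f.comp (Polynomial.C ((p : ℤ) ^ e) * Polynomial.X + Polynomial.C x)
  have hP0 : ∀ x, ¬ P x 0 := by
    intro x hx
    have h1 : Polynomial.C ((p : ℤ) ^ k) ∣ f :=
      Polynomial.C_dvd_of_C_dvd_comp_X_add_C (x := x) (by simpa [P] using hx)
    rw [← Polynomial.dvd_content_iff_C_dvd, hcont] at h1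
    have h2 : (p : ℤ) ∣ 1 := (dvd_pow_self _ hk.ne').trans h1
    exact (Nat.prime_iff_prime_int.1 hp.out).not_dvd_one h2
  have hmove : ∀ {x y : ℤ} {e : ℕ}, P x e → (p : ℤ) ^ e ∣ y - x → P y e :=
    fun h h' => Polynomial.C_dvd_comp_of_dvd_sub h h'
  let R := {α : AlgebraicClosure ℚ_[p] //
          Polynomial.aeval α f = 0 ∧
          ((algebraMap ℚ_[p] (AlgebraicClosure ℚ_[p])).comp
            (PadicInt.Coe.ringHom)).IsIntegralElem α}
  have hR : Finite R := by
    refine Set.Finite.to_subtype ((f.rootSet_finite (AlgebraicClosure ℚ_[p])).subset ?_)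
    exact fun α hα => (Polynomial.mem_rootSet.2 ⟨hf0, hα.1⟩)
  -- the largest disc about a solution, together with a nearby integral root
  have hex : ∀ x : ℤ, (p : ℤ) ^ k ∣ f.eval x → ∃ (m : ℕ) (α : R), m + 1 ≤ k ∧ P x (m + 1) ∧
      (∀ e ≤ m, ¬ P x e) ∧ ‖(α.1 : PadicAlgCl p) - (x : PadicAlgCl p)‖ < ((p : ℝ)⁻¹) ^ m := by
    classical
    intro x hx
    have hk' : ∃ e, P x e := ⟨k, Polynomial.C_dvd_comp_of_dvd_eval hx⟩
    obtain ⟨m, hm⟩ : ∃ m, Nat.find hk' = m + 1 :=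
      Nat.exists_eq_succ_of_ne_zero fun h => hP0 x (h ▸ Nat.find_spec hk')
    have hnot : ∀ e ≤ m, ¬ P x e := fun e he => Nat.find_min hk' (by omega)
    obtain ⟨α, hα0, hα⟩ := PadicAlgCl.exists_root_norm_sub_lt hx (hnot m le_rfl)
    have hα1 : ‖α‖ ≤ 1 := by
      rw [← sub_add_cancel α (x : PadicAlgCl p)]
      exact (IsUltrametricDist.norm_add_le_max _ _).trans
        (max_le (hα.le.trans (pow_le_one₀ hpi0.le hpi1.le)) (PadicAlgCl.norm_intCast_le_one x))
    exact ⟨m, ⟨α, hα0, PadicAlgCl.isIntegralElem_of_norm_le_one hα1⟩,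
      hm ▸ Nat.find_min' hk' (Polynomial.C_dvd_comp_of_dvd_eval hx), hm ▸ Nat.find_spec hk',
      hnot, hα⟩
  choose m a hmk hPm hPnot hnear using hex
  have hsame : ∀ x hx y hy, a x hx = a y hy → (p : ℤ) ^ (m x hx + 1) ∣ y - x := by
    have hle : ∀ x hx y hy, a x hx = a y hy → m x hx ≤ m y hy →
        (p : ℤ) ^ (m x hx + 1) ∣ y - x := by
      intro x hx y hy hxy hm
      rw [← PadicAlgCl.norm_intCast_lt_iff, Int.cast_sub,
        ← sub_add_sub_cancel' ((a x hx).1 : PadicAlgCl p)]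
      refine (IsUltrametricDist.norm_add_le_max _ _).trans_lt (max_lt (hnear x hx) ?_)
      rw [norm_sub_rev, hxy]
      exact (hnear y hy).trans_le (pow_le_pow_of_le_one hpi0.le hpi1.le hm)
    intro x hx y hy hxy
    rcases le_total (m x hx) (m y hy) with h | h
    · exact hle x hx y hy hxy h
    · have h1 := hle y hy x hx hxy.symm h
      have h2 : m x hx ≤ m y hy := by
        by_contra! hlt
        exact hPnot x hx _ hlt (hmove (hPm y hy) h1)
      exact hle x hx y hy hxy h2
  let A := {α : R // ∃ x hx, a x hx = α}
  choose r hr har using fun α : A => α.2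
  let E : Fin (Nat.card A) ≃ A := (Finite.equivFin A).symm
  have hpk : ((p : ℤ) ^ k) ≠ 0 := pow_ne_zero _ (by exact_mod_cast hp.out.ne_zero)
  let M : A → ℕ := fun α => m (r α) (hr α) + 1
  have hMk : ∀ α, M α ≤ k := fun α => hmk _ _
  have hcast : ∀ α : A, (((r α % (p : ℤ) ^ k).toNat : ℕ) : ℤ) = r α % (p : ℤ) ^ k :=
    fun α => Int.toNat_of_nonneg (Int.emod_nonneg _ hpk)
  have hcr : ∀ α : A, (p : ℤ) ^ M α ∣ r α % (p : ℤ) ^ k - r α := fun α =>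
    (pow_dvd_pow _ (hMk α)).trans ((Int.mod_modEq _ _).symm.dvd)
  have hPc : ∀ α : A, P (r α % (p : ℤ) ^ k) (M α) := fun α => hmove (hPm _ _) (hcr α)
  refine ⟨Nat.card A, fun i => (r (E i) % (p : ℤ) ^ k).toNat, fun i => k - M (E i),
    Nat.card_le_card_of_injective (Subtype.val : A → R) Subtype.val_injective,
    fun i => Nat.sub_le _ _, ?_, ?_⟩
  · intro x
    simp only [hcast, Nat.sub_sub_self (hMk _)]
    constructor
    · intro hx
      refine ⟨E.symm ⟨a x hx, x, hx, rfl⟩, ?_⟩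
      rw [Equiv.apply_symm_apply]
      set α : A := ⟨a x hx, x, hx, rfl⟩
      have h1 := hsame (r α) (hr α) x hx (har α)
      simpa using dvd_sub h1 (hcr α)
    · rintro ⟨i, hi⟩
      exact Polynomial.dvd_eval_of_C_dvd_comp (hmove (hPc (E i)) hi)
  · intro i
    simp only [hcast, Nat.sub_sub_self (hMk _)]
    exact (Polynomial.C_dvd_iff_dvd_coeff _ _).1 (hPc (E i))
end

section
/- Let F(x,y) ∈ ℤ[x,y] be an integral binary form of degree n, let f(X) = F(X,1), let p be a prime, and let a be an integer with p | f(a) and p ∤ f′(a) (i.e., a is a simple root of f modulo p). Write F(px + ay, y) = e₀xⁿ + e₁x^{n−1}y + ⋯ + e_n yⁿ. Then p divides every eⱼ, e_{n−1} = p·f′(a), p² does not divide e_{n−1} (so the content of F(px+ay,y) is exactly divisible by p), and the binary form (1/p)·F(px + ay, y) is congruent modulo p to y^{n−1}·(f′(a)·x + (f(a)/p)·y), a form of the shape y^{n−1}L(x,y) with the coefficient of x in L nonzero modulo p. -/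
open Finset

theorem formPolyX_eval_eq_binEval {n : ℕ} (c : Fin (n + 1) → ℤ) (x : ℤ) :
    (formPolyX ℤ c).eval x = binEval c x 1 := by
  simp [formPolyX, binEval, Polynomial.eval_finsetSum]

theorem formPolyX_coeff_sub {n : ℕ} (c : Fin (n + 1) → ℤ) (j : Fin (n + 1)) :
    (formPolyX ℤ c).coeff (n - (j : ℕ)) = c j := by
  rw [formPolyX, Polynomial.finsetSum_coeff, Finset.sum_eq_single j]
  · simp
  · intro i _ hij
    have hne : n - (j : ℕ) ≠ n - (i : ℕ) := by
      have := Fin.val_ne_of_ne hij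
      omega
    simp only [Polynomial.coeff_C_mul, Polynomial.coeff_X_pow, if_neg hne, mul_zero]
  · simp

theorem coeff_eq_pow_mul_taylor_coeff {n : ℕ} (c e : Fin (n + 1) → ℤ) (q a : ℤ)
    (he : ∀ x y : ℤ, binEval e x y = binEval c (q * x + a * y) y) (j : Fin (n + 1)) :
    e j = (Polynomial.taylor a (formPolyX ℤ c)).coeff (n - (j : ℕ)) * q ^ (n - (j : ℕ)) := by
  have h : formPolyX ℤ e = (Polynomial.taylor a (formPolyX ℤ c)).comp
      (Polynomial.C q * Polynomial.X) := by
    refine Polynomial.funext fun x => ?_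
    rw [formPolyX_eval_eq_binEval, he, mul_one, ← formPolyX_eval_eq_binEval]
    simp [Polynomial.taylor_apply]
  rw [← formPolyX_coeff_sub e j, h, Polynomial.comp_C_mul_X_coeff]

/-- if `a` is a simple root of `f(X) = F(X,1)` modulo `p`, and
`F(px + ay, y) = e₀ xⁿ + e₁ x^(n-1) y + ⋯ + eₙ yⁿ`, then `p` divides every `eⱼ`,
`e_(n-1) = p f'(a)` exactly (so the content of `F(px+ay,y)` is exactly divisible by `p`),
and `(1/p) F(px+ay, y) ≡ y^(n-1) (f'(a) x + (f(a)/p) y) (mod p)`, i.e. `p² ∣ eⱼ` for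
`j ≤ n-2` and `eₙ ≡ f(a) (mod p²)`. -/
theorem simple_root_transform
    (n : ℕ) (hn : 1 ≤ n) (c : Fin (n + 1) → ℤ)
    (p : ℕ) (hp : p.Prime) (a : ℤ)
    (hroot : (p : ℤ) ∣ (formPolyX ℤ c).eval a)
    (hsimple : ¬ (p : ℤ) ∣ (Polynomial.derivative (formPolyX ℤ c)).eval a)
    (e : Fin (n + 1) → ℤ)
    (he : ∀ x y : ℤ, binEval e x y = binEval c ((p : ℤ) * x + a * y) y) :
    (∀ j, (p : ℤ) ∣ e j) ∧
    e ⟨n - 1, by omega⟩ = (p : ℤ) * (Polynomial.derivative (formPolyX ℤ c)).eval a ∧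
    ¬ ((p : ℤ) ^ 2 ∣ e ⟨n - 1, by omega⟩) ∧
    (∀ j : Fin (n + 1), (j : ℕ) + 2 ≤ n → (p : ℤ) ^ 2 ∣ e j) ∧
    (p : ℤ) ^ 2 ∣ (e (Fin.last n) - (formPolyX ℤ c).eval a) := by
  have key := coeff_eq_pow_mul_taylor_coeff c e p a he
  have hlast : e (Fin.last n) = (formPolyX ℤ c).eval a := by
    simpa using key (Fin.last n)
  have hpen : e ⟨n - 1, by omega⟩ =
      (p : ℤ) * (Polynomial.derivative (formPolyX ℤ c)).eval a := by
    rw [key, show n - (n - 1) = 1 by omega, Polynomial.taylor_coeff_one, pow_one, mul_comm]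
  refine ⟨fun j => ?_, hpen, ?_, fun j hj => ?_, ?_⟩
  · rcases eq_or_ne j (Fin.last n) with rfl | hj
    · rwa [hlast]
    · have hj' : (j : ℕ) < n := Fin.val_lt_last hj
      rw [key]
      exact dvd_mul_of_dvd_right (dvd_pow_self _ (by omega)) _
  · rw [hpen, pow_two]
    exact fun h => hsimple
      (Int.dvd_of_mul_dvd_mul_left (by exact_mod_cast hp.ne_zero) h)
  · rw [key]
    exact dvd_mul_of_dvd_right (pow_dvd_pow _ (by omega)) _
  · simp [hlast]
end

section
/- Let F(x,y) ∈ ℤ[x,y] be an integral binary form of degree n ≥ 3 that is irreducible over ℚ, and suppose the Galois group of the splitting field of F(x,1) over ℚ is isomorphic to the full symmetric group S_n. If A ∈ GL₂(ℚ) satisfies F^A = F, then A is the identity matrix when n is odd, and A = ±I when n is even. -/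
open Finset

open Polynomial in
theorem Polynomial.Gal.card_rootSet_and_galActionHom_surjective {k E : Type*} [Field k]
    [Field E] [Algebra k E] {p : k[X]} [Fact (p.map (algebraMap k E)).Splits] {n : ℕ} (hn : 2 ≤ n) (hdeg : p.natDegree ≤ n) (h : Nonempty (p.Gal ≃* Equiv.Perm (Fin n))) :
    Fintype.card (p.rootSet E) = n ∧
      Function.Surjective (Polynomial.Gal.galActionHom p E) := by
  classical
  obtain ⟨e⟩ := h
  have hinj := Polynomial.Gal.galActionHom_injective p E
  have hle : Fintype.card (p.rootSet E) ≤ n := by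
    rw [Fintype.card_eq_nat_card]
    exact (p.ncard_rootSet_le E).trans hdeg
  have hG : Nat.card p.Gal = n.factorial := by
    rw [Nat.card_congr e.toEquiv, Nat.card_perm, Nat.card_fin]
  have hP : Nat.card (Equiv.Perm (p.rootSet E)) =
      (Fintype.card (p.rootSet E)).factorial := by
    rw [Nat.card_perm, Nat.card_eq_fintype_card]
  have hcard : n.factorial ≤ (Fintype.card (p.rootSet E)).factorial := by
    rw [← hG, ← hP]
    exact Nat.card_le_card_of_injective _ hinj
  have heq : Fintype.card (p.rootSet E) = n := by
    refine le_antisymm hle (not_lt.mp fun hlt => hcard.not_gt ?_)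
    exact (Nat.factorial_le (Nat.le_sub_one_of_lt hlt)).trans_lt
      ((Nat.factorial_lt (by omega)).mpr (by omega))
  refine ⟨heq, (hinj.bijective_of_nat_card_le ?_).surjective⟩
  rw [hG, hP, heq]

theorem binEval_mul_mul {n : ℕ} {R : Type*} [CommRing R] (c : Fin (n + 1) → R) (s x y : R) :
    binEval c (s * x) (s * y) = s ^ n * binEval c x y := by
  simp only [binEval, Finset.mul_sum]
  refine Finset.sum_congr rfl fun i _ => ?_
  have hi : n - (i : ℕ) + i = n := by omega
  calc _ = s ^ (n - (i : ℕ) + i) * (c i * x ^ (n - (i : ℕ)) * y ^ (i : ℕ)) := by ring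
    _ = _ := by rw [hi]

theorem map_binEval {n : ℕ} {R S : Type*} [CommRing R] [CommRing S] (φ : R →+* S)
    (c : Fin (n + 1) → R) (x y : R) :
    φ (binEval c x y) = binEval (fun i => φ (c i)) (φ x) (φ y) := by
  simp [binEval]

theorem binEval_zero_right {n : ℕ} {R : Type*} [CommRing R] (c : Fin (n + 1) → R) (x : R) :
    binEval c x 0 = c 0 * x ^ n := by
  simp [binEval, Fin.sum_univ_succ]

theorem aeval_formPolyX {n : ℕ} {R S : Type*} [CommRing R] [CommRing S] [Algebra R S]
    (c : Fin (n + 1) → ℤ) (x : S) :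
    Polynomial.aeval x (formPolyX R c) = binEval (fun i => (c i : S)) x 1 := by
  simp [formPolyX, binEval]

theorem natDegree_formPolyX_le {n : ℕ} {R : Type*} [CommRing R] (c : Fin (n + 1) → ℤ) :
    (formPolyX R c).natDegree ≤ n :=
  Polynomial.natDegree_sum_le_of_forall_le _ _ fun _ _ =>
    (Polynomial.natDegree_C_mul_X_pow_le _ _).trans (Nat.sub_le _ _)

theorem natDegree_formPolyX_lt {n : ℕ} {R : Type*} [CommRing R] (hn : 0 < n)
    (c : Fin (n + 1) → ℤ) (h : c 0 = 0) : (formPolyX R c).natDegree < n := by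
  refine lt_of_le_of_lt (b := n - 1) ?_ (by omega)
  refine Polynomial.natDegree_sum_le_of_forall_le _ _ fun i _ => ?_
  rcases eq_or_ne i 0 with rfl | hi
  · simp [h]
  · have : 0 < (i : ℕ) := Fin.pos_iff_ne_zero.mpr hi
    exact (Polynomial.natDegree_C_mul_X_pow_le _ _).trans (by omega)

/-- Invariance of a binary form under a linear substitution extends from an infinite domain `k`
to the points `(x, 1)` over any `k`-algebra. -/
theorem binEval_linear_substitution_of_forall {n : ℕ} {k K : Type*} [CommRing k] [IsDomain k]
    [Infinite k] [CommRing K] [Algebra k K] {F : Fin (n + 1) → ℤ} {a b c d : k}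
    (h : ∀ x y : k, binEval (fun i => (F i : k)) (a * x + b * y) (c * x + d * y) =
      binEval (fun i => (F i : k)) x y) (x : K) :
    binEval (fun i => (F i : K)) (algebraMap k K a * x + algebraMap k K b)
      (algebraMap k K c * x + algebraMap k K d) = binEval (fun i => (F i : K)) x 1 := by
  open Polynomial in
  have hpoly : binEval (fun i => (F i : k[X])) (C a * X + C b) (C c * X + C d) =
      binEval (fun i => (F i : k[X])) X 1 := by
    refine Polynomial.funext fun t => ?_
    have := h t 1
    rw [← Polynomial.coe_evalRingHom, map_binEval, map_binEval]
    simpa using this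
  have := congrArg (Polynomial.aeval x : Polynomial k →ₐ[k] K).toRingHom hpoly
  rw [map_binEval, map_binEval] at this
  simpa using this

/-- A quadratic polynomial with three distinct roots vanishes identically. -/
theorem quadratic_coeffs_eq_zero {K : Type*} [Field K] {p q r x y z : K} (hxy : x ≠ y)
    (hxz : x ≠ z) (hyz : y ≠ z) (hx : p * x ^ 2 + q * x + r = 0) (hy : p * y ^ 2 + q * y + r = 0)
    (hz : p * z ^ 2 + q * z + r = 0) : p = 0 ∧ q = 0 ∧ r = 0 := by
  have h1 : p * (x + y) + q = 0 :=
    mul_left_cancel₀ (sub_ne_zero.mpr hxy) (by linear_combination hx - hy)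
  have h2 : p * (x + z) + q = 0 :=
    mul_left_cancel₀ (sub_ne_zero.mpr hxz) (by linear_combination hx - hz)
  have hp : p = 0 := mul_right_cancel₀ (sub_ne_zero.mpr hyz) (by linear_combination h1 - h2)
  have hq : q = 0 := by simpa [hp] using h1
  exact ⟨hp, hq, by simpa [hp, hq] using hx⟩

/-- If the Galois group acts as the full symmetric group on at least three roots, then a root
lying in the field generated by a root `x`, in the sense of being fixed by the stabilizer of `x`,
is `x` itself. -/
theorem Polynomial.Gal.eq_of_stabilizer_fixes {k E : Type*} [Field k] [Field E]
    [Algebra k E] [Normal k E] {p : Polynomial k} [Fact (p.map (algebraMap k E)).Splits]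
    (hcard : 3 ≤ Fintype.card (p.rootSet E))
    (hsurj : Function.Surjective (Polynomial.Gal.galActionHom p E))
    {x y : E} (hx : x ∈ p.rootSet E)
    (hy : y ∈ p.rootSet E)
    (hfix : ∀ g : E ≃ₐ[k] E, g x = x → g y = y) : y = x := by
  classical
  by_contra hne
  obtain ⟨z, hz⟩ : ∃ z, z ∉ ({⟨x, hx⟩, ⟨y, hy⟩} : Finset (p.rootSet E)) := by
    by_contra! hall
    have := Finset.card_le_card (fun z _ => hall z : (Finset.univ : Finset _) ⊆ _)
    have h2 := Finset.card_le_two (a := (⟨x, hx⟩ : p.rootSet E)) (b := ⟨y, hy⟩)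
    rw [Finset.card_univ] at this
    omega
  simp only [Finset.mem_insert, Finset.mem_singleton, not_or] at hz
  obtain ⟨g, hg⟩ := hsurj (Equiv.swap ⟨y, hy⟩ z)
  obtain ⟨g', rfl⟩ := (Polynomial.Gal.restrict_surjective p E) g
  have key (w : p.rootSet E) : g' w = (Equiv.swap ⟨y, hy⟩ z w).1 := by
    rw [← hg, Polynomial.Gal.galActionHom_restrict]
  have hgx : g' x = x := by
    rw [key ⟨x, hx⟩, Equiv.swap_apply_of_ne_of_ne (by simpa using Ne.symm hne) (Ne.symm hz.1)]
  have hgy := key ⟨y, hy⟩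
  rw [Equiv.swap_apply_left, hfix g' hgx] at hgy
  exact hz.2 (Subtype.ext hgy.symm)

/-- an irreducible binary form of degree `n ≥ 3` with Galois group `Sₙ` has
trivial stabilizer in `GL₂(ℚ)` (`±1` when `n` is even). -/
theorem stabilizer_trivial
    (n : ℕ) (hn : 3 ≤ n) (F : Fin (n + 1) → ℤ)
    (hirr : Irreducible (formPoly ℚ F))
    (hgal : Nonempty ((formPolyX ℚ F).Gal ≃* Equiv.Perm (Fin n)))
    (a b c d : ℚ) (hdet : a * d - b * c ≠ 0)
    (hfix : ∀ x y : ℚ, binEval (fun i => ((F i : ℚ))) (a * x + b * y) (c * x + d * y)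
      = binEval (fun i => ((F i : ℚ))) x y) :
    (Odd n → a = 1 ∧ b = 0 ∧ c = 0 ∧ d = 1) ∧
    (Even n → ((a = 1 ∧ b = 0 ∧ c = 0 ∧ d = 1) ∨
      (a = -1 ∧ b = 0 ∧ c = 0 ∧ d = -1))) := by
  have : Fact ((formPolyX ℚ F).map (algebraMap ℚ (AlgebraicClosure ℚ))).Splits :=
    ⟨IsAlgClosed.splits _⟩
  obtain ⟨hcard, hsurj⟩ := Polynomial.Gal.card_rootSet_and_galActionHom_surjective
    (E := AlgebraicClosure ℚ) (by omega) (natDegree_formPolyX_le F) hgal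
  have : Normal ℚ (AlgebraicClosure ℚ) := by
    have : Algebra.IsAlgebraic ℚ (AlgebraicClosure ℚ) := by
      convert AlgebraicClosure.isAlgebraic ℚ
      · rfl
      · exact Subsingleton.elim _ _
    exact normal_iff.mpr fun x => ⟨Algebra.IsIntegral.isIntegral x, IsAlgClosed.splits _⟩
  have hF0 : F 0 ≠ 0 := by
    intro h
    have hlt : (formPolyX ℚ F).natDegree < n := natDegree_formPolyX_lt (by omega) F h
    have hle := (formPolyX ℚ F).ncard_rootSet_le (AlgebraicClosure ℚ)
    rw [← Nat.card_coe_set_eq, Nat.card_eq_fintype_card] at hle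
    omega
  have hf0 : formPolyX ℚ F ≠ 0 := by
    intro h
    have hle := (formPolyX ℚ F).ncard_rootSet_le (AlgebraicClosure ℚ)
    rw [← Nat.card_coe_set_eq, Nat.card_eq_fintype_card, h, Polynomial.natDegree_zero] at hle
    rw [h] at hcard
    omega
  let φ := algebraMap ℚ (AlgebraicClosure ℚ)
  have hquad (x : (formPolyX ℚ F).rootSet (AlgebraicClosure ℚ)) :
      φ c * x.1 ^ 2 + φ (d - a) * x.1 + φ (-b) = 0 := by
    obtain ⟨x, hx⟩ := x
    have hroot : binEval (fun i => (F i : AlgebraicClosure ℚ)) x 1 = 0 := by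
      rw [← aeval_formPolyX (R := ℚ)]
      exact (Polynomial.mem_rootSet.mp hx).2
    have hsub := (binEval_linear_substitution_of_forall hfix x).trans hroot
    have hden : φ c * x + φ d ≠ 0 := by
      intro h0
      rw [h0, binEval_zero_right] at hsub
      have hnum : φ a * x + φ b = 0 :=
        eq_zero_of_pow_eq_zero ((mul_eq_zero.mp hsub).resolve_left (by exact_mod_cast hF0))
      have hdet' : φ (a * d - b * c) ≠ 0 := (map_ne_zero φ).mpr hdet
      refine hdet' ?_
      simp only [map_sub, map_mul]
      linear_combination φ a * h0 - φ c * hnum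
    let y := (φ a * x + φ b) / (φ c * x + φ d)
    have hy : y ∈ (formPolyX ℚ F).rootSet (AlgebraicClosure ℚ) := by
      refine Polynomial.mem_rootSet.mpr ⟨hf0, ?_⟩
      rw [aeval_formPolyX]
      have h := binEval_mul_mul (fun i => (F i : AlgebraicClosure ℚ)) (φ c * x + φ d) y 1
      rw [mul_one, mul_div_cancel₀ _ hden, hsub] at h
      exact (mul_eq_zero.mp h.symm).resolve_left (pow_ne_zero _ hden)
    have hyx : y = x := Polynomial.Gal.eq_of_stabilizer_fixes (by omega) hsurj hx hy fun g hg => by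
      simp [y, φ, hg]
    have := (div_eq_iff hden).mp hyx
    simp only [map_sub, map_neg]
    linear_combination -this
  obtain ⟨x, y, z, hxy, hxz, hyz⟩ := Fintype.two_lt_card_iff.mp (by omega : 2 < Fintype.card
    ((formPolyX ℚ F).rootSet (AlgebraicClosure ℚ)))
  obtain ⟨hc, had, hb⟩ := quadratic_coeffs_eq_zero (Subtype.coe_injective.ne hxy)
    (Subtype.coe_injective.ne hxz) (Subtype.coe_injective.ne hyz) (hquad x) (hquad y) (hquad z)
  simp only [φ, map_eq_zero, neg_eq_zero, sub_eq_zero] at hc had hb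
  subst hc hb had
  have hpow : d ^ n = 1 := by
    have h := hfix 1 0
    simp only [mul_one, mul_zero, add_zero, binEval_zero_right, one_pow] at h
    exact mul_left_cancel₀ (by exact_mod_cast hF0 : (F 0 : ℚ) ≠ 0) (h.trans (mul_one _).symm)
  refine ⟨fun hodd => ?_, fun heven => ?_⟩
  · rcases (pow_eq_one_iff_of_ne_zero (by omega)).mp hpow with h | ⟨-, h⟩
    · simp [h]
    · exact absurd h (Nat.not_even_iff_odd.mpr hodd)
  · rcases (pow_eq_one_iff_of_ne_zero (by omega)).mp hpow with h | ⟨h, -⟩ <;> simp [h]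
end

section
/- Let F(x,y) ∈ ℤ[x,y] be an integral binary form of degree n and p a prime such that F(x,y) ≡ m₀·(x − a₁y)(x − a₂y)⋯(x − a_ny) (mod p), where m₀ ≢ 0 (mod p) and a₁, …, a_n are pairwise distinct modulo p. Let (x₀, y₀) ∈ ℤ² with gcd(x₀, y₀) = 1 and p | F(x₀, y₀). Then p ∤ y₀, there is a unique index i ∈ {1, …, n} with x₀ ≡ aᵢy₀ (mod p), and setting x₁ = (x₀ − aᵢy₀)/p ∈ ℤ, one has gcd(x₁, y₀) = 1 and F(px₁ + aᵢy₀, y₀) = F(x₀, y₀). -/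
open Finset

theorem eval_formPoly {n : ℕ} {R : Type*} [CommRing R] (c : Fin (n + 1) → ℤ) (x y : ℤ) :
    MvPolynomial.eval ![(x : R), (y : R)] (formPoly R c) = ((binEval c x y : ℤ) : R) := by
  simp [formPoly, formPolyR, binEval]

theorem eval_split_form {n : ℕ} {R : Type*} [CommRing R] (m : R) (a : Fin n → R) (x y : R) :
    MvPolynomial.eval ![x, y]
      (MvPolynomial.C m *
        ∏ i : Fin n, (MvPolynomial.X 0 - MvPolynomial.C (a i) * MvPolynomial.X 1)) =
      m * ∏ i : Fin n, (x - a i * y) := by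
  simp

/-- if `F ≡ m₀ (x - a₁ y) ⋯ (x - aₙ y) (mod p)` with `m₀ ≢ 0` and the `aᵢ`
pairwise distinct mod `p`, and `(x₀, y₀)` is a primitive pair with `p ∣ F(x₀, y₀)`, then
`p ∤ y₀`, there is a unique `i` with `x₀ ≡ aᵢ y₀ (mod p)`, and for
`x₁ = (x₀ - aᵢ y₀)/p` one has `gcd(x₁, y₀) = 1` and `F(p x₁ + aᵢ y₀, y₀) = F(x₀, y₀)`. -/
theorem descent_at_split_prime
    {n : ℕ} (c : Fin (n + 1) → ℤ) (p : ℕ) (hp : p.Prime)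
    (m₀ : ℤ) (a : Fin n → ℤ)
    (hm₀ : (m₀ : ZMod p) ≠ 0)
    (ha : ∀ i j : Fin n, i ≠ j → ((a i : ZMod p) ≠ (a j : ZMod p)))
    (hfac : formPoly (ZMod p) c =
      MvPolynomial.C ((m₀ : ZMod p)) *
        ∏ i : Fin n, (MvPolynomial.X 0 - MvPolynomial.C ((a i : ZMod p)) * MvPolynomial.X 1))
    (x₀ y₀ : ℤ) (hcop : Int.gcd x₀ y₀ = 1) (hdvd : (p : ℤ) ∣ binEval c x₀ y₀) :
    ¬ ((p : ℤ) ∣ y₀) ∧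
    (∃! i : Fin n, (p : ℤ) ∣ (x₀ - a i * y₀)) ∧
    ∀ i : Fin n, (p : ℤ) ∣ (x₀ - a i * y₀) →
      ∀ x₁ : ℤ, x₀ - a i * y₀ = (p : ℤ) * x₁ →
        Int.gcd x₁ y₀ = 1 ∧ binEval c ((p : ℤ) * x₁ + a i * y₀) y₀ = binEval c x₀ y₀ := by
  have : Fact p.Prime := ⟨hp⟩
  have hmod : ∀ z : ℤ, (z : ZMod p) = 0 ↔ (p : ℤ) ∣ z := fun z =>
    ZMod.intCast_zmod_eq_zero_iff_dvd z p
  have hprod : (m₀ : ZMod p) * ∏ i : Fin n, ((x₀ : ZMod p) - a i * y₀) = 0 := by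
    rw [← eval_split_form, ← hfac, eval_formPoly, hmod]
    exact hdvd
  have hex : ∃ i : Fin n, (x₀ : ZMod p) - a i * y₀ = 0 := by
    simpa [hm₀, Finset.prod_eq_zero_iff] using hprod
  obtain ⟨i, hi⟩ := hex
  have hiz : (p : ℤ) ∣ x₀ - a i * y₀ := by
    rw [← hmod]
    exact_mod_cast hi
  have hcop' : IsCoprime x₀ y₀ := Int.isCoprime_iff_gcd_eq_one.mpr hcop
  have hy : ¬ (p : ℤ) ∣ y₀ := fun h =>
    (Nat.prime_iff_prime_int.mp hp).not_isUnit <|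
      hcop'.isUnit_of_dvd' ((dvd_sub_left (h.mul_left (a i))).mp hiz) h
  refine ⟨hy, ⟨i, hiz, fun j hj => ?_⟩, fun k _ x₁ hx₁ => ⟨?_, ?_⟩⟩
  · by_contra hne
    have hj' : (x₀ : ZMod p) - a j * y₀ = 0 := by
      exact_mod_cast (hmod _).mpr hj
    refine ha j i hne (mul_right_cancel₀ (mt (hmod y₀).mp hy) ?_)
    linear_combination hi - hj'
  · obtain ⟨u, v, huv⟩ := hcop'
    exact Int.isCoprime_iff_gcd_eq_one.mp
      ⟨u * p, u * a k + v, by linear_combination huv - u * hx₁⟩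
  · rw [← hx₁, sub_add_cancel]
end
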